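/- For all nonnegative integers r and s, T(r,s) = (-2/(2r+1)!) · (π/2)^{2r+2s+2} · ∑_{n=0}^{∞} ζ(2n) / ((2n+2r+1)(2n+2r+2)···(2n+2r+2s+2)·2^{2n}). -/

import Mathlib

/-- The multiple zeta value `ζ(s₁,…,s_l) = ∑_{1 ≤ k₁ < ⋯ < k_l} ∏ 1/kᵢ^{sᵢ}`. -/
noncomputable def MZV (s : List ℕ) : ℝ :=
  ∑' f : {f : Fin s.length → ℕ+ // StrictMono f},
    ∏ i : Fin s.length, (1 : ℝ) / ((f.1 i : ℕ) : ℝ) ^ s.get i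

/-- The multiple t-value `t(s₁,…,s_l) = ∑_{1 ≤ k₁ < ⋯ < k_l} ∏ 1/(2kᵢ-1)^{sᵢ}`. -/
noncomputable def MTV (s : List ℕ) : ℝ :=
  ∑' f : {f : Fin s.length → ℕ+ // StrictMono f},
    ∏ i : Fin s.length, (1 : ℝ) / ((2 * (f.1 i : ℕ) - 1 : ℕ) : ℝ) ^ s.get i

open Real Filter Topology
open scoped ENNReal

/-- The tail of a multiple `t`-value, as an iterated sum: with zero-based indices,
`∑_{m ≤ j₁ < ⋯ < j_l} ∏ 1/(2jᵢ+1)^{aᵢ}`. -/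
noncomputable def mtvTail : List ℕ → ℕ → ℝ≥0∞
  | [], _ => 1
  | a :: L, m =>
    ∑' j : Set.Ici m, ENNReal.ofReal (1 / (2 * (j : ℕ) + 1 : ℝ) ^ a) * mtvTail L (j + 1)

/-- Splitting off the first entry of a strictly increasing sequence bounded below by `m`. -/
def strictMonoConsEquiv (l m : ℕ) :
    (Σ j : Set.Ici m, {g : Fin l → ℕ // StrictMono g ∧ ∀ i, (j : ℕ) + 1 ≤ g i}) ≃
      {f : Fin (l + 1) → ℕ // StrictMono f ∧ ∀ i, m ≤ f i} where
  toFun p := ⟨Fin.cons p.1.1 p.2.1, by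
    obtain ⟨⟨j, hj⟩, g, hg, hjg⟩ := p
    refine ⟨Fin.strictMono_cons.2 ⟨fun i => hjg i, hg⟩, fun i => ?_⟩
    have hj' : m ≤ j := hj
    refine Fin.cases ?_ (fun i => ?_) i
    · simpa using hj'
    · have := hjg i
      simp only [Fin.cons_succ] at this ⊢
      omega⟩
  invFun f := ⟨⟨f.1 0, f.2.2 0⟩, ⟨Fin.tail f.1, by
    refine ⟨fun a b h => f.2.1 (Fin.succ_lt_succ_iff.2 h), fun i => ?_⟩
    exact f.2.1 (Fin.succ_pos i)⟩⟩
  left_inv p := by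
    obtain ⟨⟨j, hj⟩, g, hg, hjg⟩ := p
    rfl
  right_inv f := by
    ext i
    simp

theorem mtvTail_eq_tsum (L : List ℕ) (m : ℕ) :
    mtvTail L m = ∑' f : {f : Fin L.length → ℕ // StrictMono f ∧ ∀ i, m ≤ f i},
      ∏ i, ENNReal.ofReal (1 / (2 * (f.1 i : ℕ) + 1 : ℝ) ^ L.get i) := by
  induction L generalizing m with
  | nil =>
    have : Unique {f : Fin ([] : List ℕ).length → ℕ // StrictMono f ∧ ∀ i, m ≤ f i} :=
      { default := ⟨fun i => i.elim0, fun i => i.elim0, fun i => i.elim0⟩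
        uniq := fun f => Subtype.ext (funext fun i => i.elim0) }
    rw [tsum_fintype, Fintype.sum_unique]
    simp [mtvTail]
  | cons a L ih =>
    refine Eq.trans ?_ ((strictMonoConsEquiv L.length m).tsum_eq _)
    rw [ENNReal.tsum_sigma', mtvTail]
    refine tsum_congr fun j => ?_
    rw [ih, ← ENNReal.tsum_mul_left]
    refine tsum_congr fun g => ?_
    symm
    exact Fin.prod_univ_succ _

theorem MTV_eq_toReal_mtvTail (L : List ℕ) : MTV L = (mtvTail L 0).toReal := by
  let e : {f : Fin L.length → ℕ+ // StrictMono f} ≃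
      {f : Fin L.length → ℕ // StrictMono f ∧ ∀ i, 0 ≤ f i} :=
    { toFun := fun f => ⟨fun i => (f.1 i).natPred,
        fun a b h => PNat.natPred_lt_natPred.2 (f.2 h), fun i => Nat.zero_le _⟩
      invFun := fun f => ⟨fun i => (f.1 i).succPNat,
        fun a b h => Nat.succPNat_lt_succPNat.2 (f.2.1 h)⟩
      left_inv := fun f => by ext; simp
      right_inv := fun f => by ext; simp }
  rw [mtvTail_eq_tsum, ← e.tsum_eq, ENNReal.tsum_toReal_eq]
  · refine tsum_congr fun f => ?_
    rw [ENNReal.toReal_prod]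
    refine Finset.prod_congr rfl fun i _ => ?_
    have h : ((2 * (f.1 i : ℕ) - 1 : ℕ) : ℝ) = 2 * ((f.1 i).natPred : ℝ) + 1 := by
      have h1 := PNat.natPred_add_one (f.1 i)
      have : 2 * (f.1 i : ℕ) - 1 = 2 * (f.1 i).natPred + 1 := by omega
      rw [this]; push_cast; ring
    rw [ENNReal.toReal_ofReal (by positivity), h]
    rfl
  · intro f
    exact ENNReal.prod_ne_top fun i _ => ENNReal.ofReal_ne_top

/-- The elementary symmetric functions of `1/1², 1/3², …, 1/(2j-1)²`. -/
noncomputable def oddEsymm : ℕ → ℕ → ℝ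
  | 0, _ => 1
  | r + 1, j => ∑ i ∈ Finset.range j, oddEsymm r i / (2 * i + 1) ^ 2

theorem oddEsymm_nonneg (r j : ℕ) : 0 ≤ oddEsymm r j := by
  induction r generalizing j with
  | zero => simp [oddEsymm]
  | succ r ih => exact Finset.sum_nonneg fun i _ => div_nonneg (ih i) (by positivity)

theorem oddEsymm_succ_succ (r j : ℕ) :
    oddEsymm (r + 1) (j + 1) = oddEsymm (r + 1) j + oddEsymm r j / (2 * j + 1) ^ 2 := by
  simp [oddEsymm, Finset.sum_range_succ]

/-- Summing a tail against elementary symmetric functions absorbs a leading `2`. -/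
theorem tsum_oddEsymm_mul_mtvTail_cons (r a : ℕ) (L : List ℕ) :
    ∑' j : ℕ, ENNReal.ofReal (oddEsymm r j) *
        (ENNReal.ofReal (1 / (2 * (j : ℕ) + 1 : ℝ) ^ 2) * mtvTail (a :: L) (j + 1)) =
      ∑' j : ℕ, ENNReal.ofReal (oddEsymm (r + 1) j) *
        (ENNReal.ofReal (1 / (2 * (j : ℕ) + 1 : ℝ) ^ a) * mtvTail L (j + 1)) := by
  simp only [mtvTail]
  simp_rw [tsum_subtype (Set.Ici _) (fun j : ℕ =>
    ENNReal.ofReal (1 / (2 * (j : ℕ) + 1 : ℝ) ^ a) * mtvTail L (j + 1)),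
    ← ENNReal.tsum_mul_left]
  rw [ENNReal.tsum_comm]
  refine tsum_congr fun j => ?_
  rw [oddEsymm, ENNReal.ofReal_sum_of_nonneg
    (fun i _ => div_nonneg (oddEsymm_nonneg r i) (by positivity)), Finset.sum_mul,
    tsum_eq_sum (s := Finset.range j)]
  · refine Finset.sum_congr rfl fun i hi => ?_
    rw [Set.indicator_of_mem (by simpa [Nat.succ_le_iff] using hi), ← mul_assoc,
      ← ENNReal.ofReal_mul (oddEsymm_nonneg r i), mul_one_div]
  · intro i hi
    rw [Set.indicator_of_notMem (by simpa [Nat.succ_le_iff] using hi)]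
    simp

theorem tsum_oddEsymm_mul_mtvTail_replicate (q r a : ℕ) (L : List ℕ) :
    ∑' j : ℕ, ENNReal.ofReal (oddEsymm q j) * (ENNReal.ofReal (1 / (2 * (j : ℕ) + 1 : ℝ) ^ 2) *
        mtvTail (List.replicate r 2 ++ a :: L) (j + 1)) =
      ∑' j : ℕ, ENNReal.ofReal (oddEsymm (q + r + 1) j) *
        (ENNReal.ofReal (1 / (2 * (j : ℕ) + 1 : ℝ) ^ a) * mtvTail L (j + 1)) := by
  induction r generalizing q with
  | zero => exact tsum_oddEsymm_mul_mtvTail_cons q a L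
  | succ r ih =>
    rw [List.replicate_succ, List.cons_append, tsum_oddEsymm_mul_mtvTail_cons, ih,
      show q + 1 + r + 1 = q + (r + 1) + 1 by ring]

theorem mtvTail_cons_zero (a : ℕ) (L : List ℕ) :
    mtvTail (a :: L) 0 = ∑' j : ℕ, ENNReal.ofReal (oddEsymm 0 j) *
        (ENNReal.ofReal (1 / (2 * (j : ℕ) + 1 : ℝ) ^ a) * mtvTail L (j + 1)) := by
  rw [mtvTail, tsum_subtype (Set.Ici 0) (fun j : ℕ =>
    ENNReal.ofReal (1 / (2 * (j : ℕ) + 1 : ℝ) ^ a) * mtvTail L (j + 1))]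
  simp [oddEsymm]

theorem mtvTail_replicate_two_append (r a : ℕ) (L : List ℕ) :
    mtvTail (List.replicate r 2 ++ a :: L) 0 =
      ∑' j : ℕ, ENNReal.ofReal (oddEsymm r j) *
        (ENNReal.ofReal (1 / (2 * (j : ℕ) + 1 : ℝ) ^ a) * mtvTail L (j + 1)) := by
  cases r with
  | zero => exact mtvTail_cons_zero a L
  | succ r =>
    rw [List.replicate_succ, List.cons_append, mtvTail_cons_zero,
      tsum_oddEsymm_mul_mtvTail_replicate, zero_add]

theorem hasDerivAt_const_sub_pow_div_factorial (c x : ℝ) (n : ℕ) :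
    HasDerivAt (fun y : ℝ => (c - y) ^ (n + 1) / ((n + 1).factorial : ℝ))
      (-((c - x) ^ n / (n.factorial : ℝ))) x := by
  have h := (((hasDerivAt_id x).const_sub c).pow (n + 1)).div_const ((n + 1).factorial : ℝ)
  refine h.congr_deriv ?_
  have : (n.factorial : ℝ) ≠ 0 := by positivity
  have : (n + 1 : ℝ) ≠ 0 := by positivity
  simp only [Nat.factorial_succ, id]
  push_cast
  field_simp

theorem hasDerivAt_sin_pow (n : ℕ) (x : ℝ) :
    HasDerivAt (fun y : ℝ => sin y ^ (n + 1)) ((n + 1) * sin x ^ n * cos x) x := by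
  simpa using (hasDerivAt_sin x).fun_pow (n + 1)

theorem hasDerivAt_deriv_sin_pow (n : ℕ) (x : ℝ) :
    HasDerivAt (fun y : ℝ => (n + 2) * sin y ^ (n + 1) * cos y)
      ((n + 2) * (n + 1) * sin x ^ n - (n + 2) ^ 2 * sin x ^ (n + 2)) x := by
  refine (((hasDerivAt_sin_pow n x).const_mul ((n : ℝ) + 2)).mul (hasDerivAt_cos x)).congr_deriv ?_
  have := cos_sq' x
  linear_combination ((n : ℝ) + 2) * (n + 1) * sin x ^ n * this

/-- The moments `∫₀^{π/2} sin^{2j+1} θ (π/2-θ)^{2s}/(2s)! dθ`. -/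
noncomputable def sinMoment (s j : ℕ) : ℝ :=
  ∫ θ in (0 : ℝ)..π / 2, sin θ ^ (2 * j + 1) * ((π / 2 - θ) ^ (2 * s) / ((2 * s).factorial : ℝ))

theorem sinMoment_zero_zero : sinMoment 0 0 = 1 := by
  simp [sinMoment]

theorem sinMoment_zero_succ (j : ℕ) :
    sinMoment 0 (j + 1) = (2 * j + 2) / (2 * j + 3) * sinMoment 0 j := by
  have h := integral_sin_pow (a := 0) (b := π / 2) (2 * j + 1)
  simp only [sinMoment, mul_zero, pow_zero, Nat.factorial_zero, Nat.cast_one, div_one, mul_one]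
  rw [show 2 * (j + 1) + 1 = 2 * j + 1 + 2 by ring, h]
  simp only [sin_zero, cos_pi_div_two]
  push_cast
  ring

theorem inv_le_sinMoment_zero (j : ℕ) : (2 * j + 1 : ℝ)⁻¹ ≤ sinMoment 0 j := by
  induction j with
  | zero => simp [sinMoment_zero_zero]
  | succ j ih =>
    rw [sinMoment_zero_succ]
    refine le_trans ?_ (mul_le_mul_of_nonneg_left ih (by positivity))
    push_cast
    rw [← div_eq_mul_inv, div_div, inv_eq_one_div, div_le_div_iff₀ (by positivity) (by positivity)]
    nlinarith [(Nat.cast_nonneg j : (0 : ℝ) ≤ j)]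

theorem sinMoment_zero_pos (j : ℕ) : 0 < sinMoment 0 j :=
  lt_of_lt_of_le (by positivity) (inv_le_sinMoment_zero j)

theorem sinMoment_recurrence (s j : ℕ) :
    (2 * j + 3) ^ 2 * sinMoment (s + 1) (j + 1) + sinMoment s (j + 1) =
      (2 * j + 3) * (2 * j + 2) * sinMoment (s + 1) j := by
  let N : ℕ := 2 * j + 1
  let B : ℝ → ℝ := fun θ =>
    (π / 2 - θ) ^ (2 * s + 1 + 1) / ((2 * s + 1 + 1).factorial : ℝ) *
        ((N + 2) * sin θ ^ (N + 1) * cos θ) +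
      (π / 2 - θ) ^ (2 * s + 1) / ((2 * s + 1).factorial : ℝ) * sin θ ^ (N + 1 + 1)
  have hB : ∀ θ, HasDerivAt B
      ((2 * j + 3) * (2 * j + 2) * (sin θ ^ (2 * j + 1) *
          ((π / 2 - θ) ^ (2 * (s + 1)) / ((2 * (s + 1)).factorial : ℝ))) -
        ((2 * j + 3) ^ 2 * (sin θ ^ (2 * (j + 1) + 1) *
          ((π / 2 - θ) ^ (2 * (s + 1)) / ((2 * (s + 1)).factorial : ℝ))) +
        sin θ ^ (2 * (j + 1) + 1) * ((π / 2 - θ) ^ (2 * s) / ((2 * s).factorial : ℝ)))) θ := by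
    intro θ
    refine (((hasDerivAt_const_sub_pow_div_factorial (π / 2) θ (2 * s + 1)).mul
      (hasDerivAt_deriv_sin_pow N θ)).add
      ((hasDerivAt_const_sub_pow_div_factorial (π / 2) θ (2 * s)).mul
        (hasDerivAt_sin_pow (N + 1) θ))).congr_deriv ?_
    rw [show 2 * (s + 1) = 2 * s + 1 + 1 by ring]
    simp only [N]
    push_cast
    ring
  have hparts := intervalIntegral.integral_eq_sub_of_hasDerivAt (a := 0) (b := π / 2)
    (fun θ _ => hB θ) (Continuous.intervalIntegrable (by fun_prop) _ _)
  rw [intervalIntegral.integral_sub (Continuous.intervalIntegrable (by fun_prop) _ _)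
    (Continuous.intervalIntegrable (by fun_prop) _ _),
    intervalIntegral.integral_add (Continuous.intervalIntegrable (by fun_prop) _ _)
    (Continuous.intervalIntegrable (by fun_prop) _ _),
    intervalIntegral.integral_const_mul, intervalIntegral.integral_const_mul] at hparts
  simp only [B, sin_zero, cos_pi_div_two, sub_self] at hparts
  simp only [sinMoment]
  simp at hparts ⊢
  linarith

theorem sinMoment_nonneg (s j : ℕ) : 0 ≤ sinMoment s j := by
  refine intervalIntegral.integral_nonneg (by positivity) fun θ hθ => ?_
  have h1 : 0 ≤ sin θ := sin_nonneg_of_nonneg_of_le_pi hθ.1 (by linarith [hθ.2, pi_pos])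
  have h2 : 0 ≤ π / 2 - θ := by linarith [hθ.2]
  positivity

theorem sinMoment_succ_le (s j : ℕ) :
    sinMoment (s + 1) j ≤ (π / 2) ^ (2 * s + 2) * (sinMoment 0 j / (2 * j + 3)) := by
  have h : sinMoment 0 j / (2 * j + 3) = sinMoment 0 j - sinMoment 0 (j + 1) := by
    rw [sinMoment_zero_succ]
    field_simp
    ring
  rw [h]
  simp only [sinMoment]
  rw [← intervalIntegral.integral_sub (Continuous.intervalIntegrable (by fun_prop) _ _)
    (Continuous.intervalIntegrable (by fun_prop) _ _), ← intervalIntegral.integral_const_mul]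
  refine intervalIntegral.integral_mono_on (by positivity)
    (Continuous.intervalIntegrable (by fun_prop) _ _)
    (Continuous.intervalIntegrable (by fun_prop) _ _) fun θ hθ => ?_
  have h1 : 0 ≤ sin θ := sin_nonneg_of_nonneg_of_le_pi hθ.1 (by linarith [hθ.2, pi_pos])
  have h2 : 0 ≤ π / 2 - θ := by linarith [hθ.2]
  have h3 : π / 2 - θ ≤ π / 2 * cos θ := by
    have := mul_le_sin h2 (by linarith [hθ.1])
    rw [sin_pi_div_two_sub] at this
    calc π / 2 - θ = π / 2 * (2 / π * (π / 2 - θ)) := by field_simp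
      _ ≤ _ := by gcongr
  have h4 : 0 ≤ cos θ := by
    by_contra hc
    nlinarith [pi_pos]
  have h5 : (π / 2 - θ) ^ (2 * (s + 1)) ≤ (π / 2) ^ (2 * s + 2) * cos θ ^ 2 := by
    calc (π / 2 - θ) ^ (2 * (s + 1)) ≤ (π / 2 * cos θ) ^ (2 * (s + 1)) := by gcongr
      _ = (π / 2) ^ (2 * s + 2) * (cos θ ^ 2 * cos θ ^ (2 * s)) := by ring
      _ ≤ (π / 2) ^ (2 * s + 2) * (cos θ ^ 2 * 1) := by
        gcongr
        exact pow_le_one₀ h4 (cos_le_one θ)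
      _ = _ := by ring
  have h6 : (π / 2 - θ) ^ (2 * (s + 1)) / ((2 * (s + 1)).factorial : ℝ) ≤
      (π / 2) ^ (2 * s + 2) * cos θ ^ 2 := by
    refine (div_le_self (by positivity) ?_).trans h5
    exact_mod_cast Nat.succ_le_of_lt (Nat.factorial_pos _)
  refine (mul_le_mul_of_nonneg_left h6 (by positivity)).trans (le_of_eq ?_)
  rw [cos_sq']
  simp
  ring

/-- The normalised moments, which are the elementary symmetric functions of
`1/(2j+3)², 1/(2j+5)², …`. -/
noncomputable def sinMomentRatio (s j : ℕ) : ℝ := sinMoment s j / sinMoment 0 j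

theorem sinMomentRatio_nonneg (s j : ℕ) : 0 ≤ sinMomentRatio s j :=
  div_nonneg (sinMoment_nonneg s j) (sinMoment_nonneg 0 j)

theorem sinMomentRatio_recurrence (s j : ℕ) :
    sinMomentRatio s (j + 1) / (2 * (j + 1 : ℕ) + 1 : ℝ) ^ 2 =
      sinMomentRatio (s + 1) j - sinMomentRatio (s + 1) (j + 1) := by
  have h := sinMoment_recurrence s j
  have h0 := sinMoment_zero_succ j
  have hp := (sinMoment_zero_pos j).ne'
  simp only [sinMomentRatio, h0]
  push_cast
  field_simp
  rw [show (2 * (j + 1) + 1 : ℝ) = 2 * j + 3 by ring]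
  have : (2 * j + 3 : ℝ) ≠ 0 := by positivity
  field_simp
  linarith

theorem tendsto_sinMomentRatio_succ (s : ℕ) :
    Tendsto (fun j => sinMomentRatio (s + 1) j) atTop (𝓝 0) := by
  have hlim : Tendsto (fun j : ℕ => (π / 2) ^ (2 * s + 2) / ((j : ℝ) + 1)) atTop (𝓝 0) :=
    tendsto_const_nhds.div_atTop
      (tendsto_atTop_add_const_right _ _ tendsto_natCast_atTop_atTop)
  refine squeeze_zero (fun j => sinMomentRatio_nonneg _ _) (fun j => ?_) hlim
  have hp := sinMoment_zero_pos j
  rw [sinMomentRatio, div_le_iff₀ hp]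
  refine (sinMoment_succ_le s j).trans ?_
  rw [mul_div_assoc', div_mul_eq_mul_div]
  gcongr <;> linarith [(Nat.cast_nonneg j : (0 : ℝ) ≤ j)]

theorem hasSum_sinMomentRatio (s j : ℕ) :
    HasSum (fun i : ℕ => sinMomentRatio s (j + 1 + i) / (2 * (j + 1 + i : ℕ) + 1 : ℝ) ^ 2)
      (sinMomentRatio (s + 1) j) := by
  rw [hasSum_iff_tendsto_nat_of_nonneg
    (fun i => div_nonneg (sinMomentRatio_nonneg _ _) (by positivity))]
  have hsum : ∀ n : ℕ, ∑ i ∈ Finset.range n,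
      sinMomentRatio s (j + 1 + i) / (2 * (j + 1 + i : ℕ) + 1 : ℝ) ^ 2 =
      sinMomentRatio (s + 1) j - sinMomentRatio (s + 1) (n + j) := by
    intro n
    induction n with
    | zero => simp
    | succ n ih =>
      rw [Finset.sum_range_succ, ih, show j + 1 + n = n + j + 1 by ring,
        sinMomentRatio_recurrence, show n + 1 + j = n + j + 1 by ring]
      ring
  simp_rw [hsum]
  simpa using ((tendsto_sinMomentRatio_succ s).comp (tendsto_add_atTop_nat j)).const_sub
    (sinMomentRatio (s + 1) j)

theorem mtvTail_replicate_two (s j : ℕ) :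
    mtvTail (List.replicate s 2) (j + 1) = ENNReal.ofReal (sinMomentRatio s j) := by
  induction s generalizing j with
  | zero => simp [mtvTail, sinMomentRatio, div_self (sinMoment_zero_pos j).ne']
  | succ s ih =>
    let e : ℕ ≃ Set.Ici (j + 1) :=
      { toFun := fun i => ⟨j + 1 + i, Nat.le_add_right _ _⟩
        invFun := fun i => i.1 - (j + 1)
        left_inv := fun i => by simp
        right_inv := fun i => Subtype.ext (Nat.add_sub_cancel' i.2) }
    have h := hasSum_sinMomentRatio s j
    rw [List.replicate_succ, mtvTail, ← e.tsum_eq, ← h.tsum_eq, ENNReal.ofReal_tsum_of_nonneg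
      (fun i => div_nonneg (sinMomentRatio_nonneg _ _) (by positivity)) h.summable]
    refine tsum_congr fun i => ?_
    rw [ih, ← ENNReal.ofReal_mul (by positivity), one_div_mul_eq_div]
    rfl

theorem nonneg_of_hasDerivAt_nonneg {g g' : ℝ → ℝ} {a : ℝ} (hg : ∀ t, HasDerivAt g (g' t) t)
    (h0 : 0 ≤ g 0) (hg' : ∀ t ∈ Set.Icc 0 a, 0 ≤ g' t) : ∀ t ∈ Set.Icc 0 a, 0 ≤ g t := by
  intro t ht
  rcases ht.1.eq_or_lt with rfl | hpos
  · exact h0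
  obtain ⟨c, hc, hslope⟩ := exists_hasDerivAt_eq_slope g g' hpos
    (fun x _ => (hg x).continuousAt.continuousWithinAt) (fun x _ => hg x)
  have h := hg' c ⟨hc.1.le, hc.2.le.trans ht.2⟩
  rw [hslope, sub_zero] at h
  have := mul_nonneg h hpos.le
  rw [div_mul_cancel₀ _ hpos.ne'] at this
  linarith

theorem nonneg_of_hasDerivAt_hasDerivAt_nonneg {f f' f'' : ℝ → ℝ} {a : ℝ}
    (hf : ∀ t, HasDerivAt f (f' t) t) (hf' : ∀ t, HasDerivAt f' (f'' t) t)
    (h0 : 0 ≤ f 0) (h0' : 0 ≤ f' 0) (hf'' : ∀ t ∈ Set.Icc 0 a, 0 ≤ f'' t) :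
    ∀ t ∈ Set.Icc 0 a, 0 ≤ f t :=
  nonneg_of_hasDerivAt_nonneg hf h0 (nonneg_of_hasDerivAt_nonneg hf' h0' hf'')

/-- Partial sums of the expansion of `θ^{2r+1}/(2r+1)!` in odd powers of `sin θ`. -/
noncomputable def sinPartialSum (r K : ℕ) (θ : ℝ) : ℝ :=
  ∑ j ∈ Finset.range K, oddEsymm r j * (sin θ ^ (2 * j + 1) / ((2 * j + 1) ^ 2 * sinMoment 0 j))

/-- The derivative of `sinPartialSum`. -/
noncomputable def sinPartialSumDeriv (r K : ℕ) (θ : ℝ) : ℝ :=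
  ∑ j ∈ Finset.range K, oddEsymm r j *
    ((2 * j + 1) * sin θ ^ (2 * j) * cos θ / ((2 * j + 1) ^ 2 * sinMoment 0 j))

/-- The second derivative of `sinPartialSum r (K + 1)`, after summation by parts. -/
noncomputable def sinPartialSumDerivTwo (r K : ℕ) (θ : ℝ) : ℝ :=
  (if r = 0 then 0 else sinPartialSum (r - 1) K θ) -
    oddEsymm r K * (sin θ ^ (2 * K + 1) / sinMoment 0 K)

theorem hasDerivAt_sinPartialSum (r K : ℕ) (θ : ℝ) :
    HasDerivAt (sinPartialSum r K) (sinPartialSumDeriv r K θ) θ := by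
  refine HasDerivAt.fun_sum fun j _ => ?_
  refine HasDerivAt.const_mul _ (HasDerivAt.div_const ?_ _)
  simpa using hasDerivAt_sin_pow (2 * j) θ

theorem hasDerivAt_sinPartialSumDeriv (r K : ℕ) (θ : ℝ) :
    HasDerivAt (sinPartialSumDeriv r (K + 1)) (sinPartialSumDerivTwo r K θ) θ := by
  induction K with
  | zero =>
    have h : sinPartialSumDeriv r 1 = fun θ => oddEsymm r 0 * cos θ := by
      funext θ
      simp [sinPartialSumDeriv, sinMoment_zero_zero]
    rw [h]
    refine ((hasDerivAt_cos θ).const_mul _).congr_deriv ?_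
    simp [sinPartialSumDerivTwo, sinPartialSum, sinMoment_zero_zero]
  | succ K ih =>
    have h : sinPartialSumDeriv r (K + 1 + 1) = fun θ => sinPartialSumDeriv r (K + 1) θ +
        oddEsymm r (K + 1) * ((((2 * K : ℕ) + 1 : ℕ) + 2) * sin θ ^ (2 * K + 1 + 1) * cos θ /
          ((2 * K + 3) ^ 2 * sinMoment 0 (K + 1))) := by
      funext θ
      simp only [sinPartialSumDeriv]
      rw [Finset.sum_range_succ _ (K + 1)]
      congr 3
      · push_cast; ring
      · push_cast; ring
    rw [h]
    refine (ih.add (((hasDerivAt_deriv_sin_pow (2 * K + 1) θ).div_const _).const_mul _)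
      ).congr_deriv ?_
    have hp := (sinMoment_zero_pos K).ne'
    have hK : (2 * K + 1 : ℝ) ≠ 0 := by positivity
    have hw : ((((2 * K + 1 : ℕ) : ℝ) + 2) * ((2 * K + 1 : ℕ) + 1) * sin θ ^ (2 * K + 1) -
        ((2 * K + 1 : ℕ) + 2) ^ 2 * sin θ ^ (2 * K + 1 + 2)) /
          ((2 * K + 3) ^ 2 * sinMoment 0 (K + 1)) =
        sin θ ^ (2 * K + 1) / sinMoment 0 K -
          sin θ ^ (2 * (K + 1) + 1) / sinMoment 0 (K + 1) := by
      have h3 : (2 * K + 3 : ℝ) ≠ 0 := by positivity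
      rw [sinMoment_zero_succ]
      push_cast
      field_simp
      ring
    rw [hw]
    cases r with
    | zero =>
      simp only [sinPartialSumDerivTwo, oddEsymm, if_true]
      ring
    | succ r =>
      simp only [sinPartialSumDerivTwo, Nat.succ_ne_zero, if_false, Nat.add_sub_cancel,
        sinPartialSum, Finset.sum_range_succ _ K, oddEsymm_succ_succ]
      field_simp
      ring

theorem sinPartialSum_nonneg (r K : ℕ) {θ : ℝ} (hθ : θ ∈ Set.Icc 0 (π / 2)) :
    0 ≤ sinPartialSum r K θ := by
  have h1 : 0 ≤ sin θ := sin_nonneg_of_nonneg_of_le_pi hθ.1 (by linarith [hθ.2, pi_pos])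
  refine Finset.sum_nonneg fun j _ => mul_nonneg (oddEsymm_nonneg r j) ?_
  have := sinMoment_zero_pos j
  positivity

theorem hasDerivAt_pow_div_factorial (n : ℕ) (x : ℝ) :
    HasDerivAt (fun y : ℝ => y ^ (n + 1) / ((n + 1).factorial : ℝ))
      (x ^ n / (n.factorial : ℝ)) x := by
  refine ((hasDerivAt_pow (n + 1) x).div_const ((n + 1).factorial : ℝ)).congr_deriv ?_
  have : (n.factorial : ℝ) ≠ 0 := by positivity
  have : (n + 1 : ℝ) ≠ 0 := by positivity
  simp only [Nat.factorial_succ]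
  push_cast
  field_simp

theorem sinPartialSum_zero_right (r K : ℕ) : sinPartialSum r K 0 = 0 := by
  simp [sinPartialSum]

theorem sinPartialSumDeriv_zero_right (r K : ℕ) :
    sinPartialSumDeriv r (K + 1) 0 = 0 ^ (2 * r) / ((2 * r).factorial : ℝ) := by
  rw [sinPartialSumDeriv, Finset.sum_range_succ']
  cases r <;> simp [oddEsymm, sinMoment_zero_zero]

/-- The second derivative of `θ^{2r+1}/(2r+1)! - sinPartialSum r (K + 1) θ`. -/
noncomputable def sinRemainderDerivTwo (r K : ℕ) (θ : ℝ) : ℝ :=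
  (if r = 0 then 0 else θ ^ (2 * (r - 1) + 1) / ((2 * (r - 1) + 1).factorial : ℝ)) -
    sinPartialSumDerivTwo r K θ

theorem sinRemainderDerivTwo_zero (K : ℕ) (θ : ℝ) :
    sinRemainderDerivTwo 0 K θ = oddEsymm 0 K * (sin θ ^ (2 * K + 1) / sinMoment 0 K) := by
  simp [sinRemainderDerivTwo, sinPartialSumDerivTwo]

theorem sinRemainderDerivTwo_succ (r K : ℕ) (θ : ℝ) :
    sinRemainderDerivTwo (r + 1) K θ =
      (θ ^ (2 * r + 1) / ((2 * r + 1).factorial : ℝ) - sinPartialSum r K θ) +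
        oddEsymm (r + 1) K * (sin θ ^ (2 * K + 1) / sinMoment 0 K) := by
  simp only [sinRemainderDerivTwo, sinPartialSumDerivTwo, Nat.succ_ne_zero, if_false,
    Nat.add_sub_cancel]
  ring

theorem hasDerivAt_sinRemainder (r K : ℕ) (θ : ℝ) :
    HasDerivAt (fun t => t ^ (2 * r + 1) / ((2 * r + 1).factorial : ℝ) - sinPartialSum r K t)
      (θ ^ (2 * r) / ((2 * r).factorial : ℝ) - sinPartialSumDeriv r K θ) θ :=
  (hasDerivAt_pow_div_factorial (2 * r) θ).sub (hasDerivAt_sinPartialSum r K θ)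

theorem hasDerivAt_sinRemainderDeriv (r K : ℕ) (θ : ℝ) :
    HasDerivAt (fun t => t ^ (2 * r) / ((2 * r).factorial : ℝ) - sinPartialSumDeriv r (K + 1) t)
      (sinRemainderDerivTwo r K θ) θ := by
  refine HasDerivAt.sub ?_ (hasDerivAt_sinPartialSumDeriv r K θ)
  cases r with
  | zero => simpa using hasDerivAt_const θ (1 : ℝ)
  | succ r => exact hasDerivAt_pow_div_factorial (2 * r + 1) θ

theorem sinRemainder_nonneg_of_derivTwo {r K : ℕ} {a : ℝ}
    (h : ∀ t ∈ Set.Icc 0 a, 0 ≤ sinRemainderDerivTwo r K t) : ∀ θ ∈ Set.Icc 0 a,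
    0 ≤ θ ^ (2 * r + 1) / ((2 * r + 1).factorial : ℝ) - sinPartialSum r (K + 1) θ :=
  nonneg_of_hasDerivAt_hasDerivAt_nonneg (hasDerivAt_sinRemainder r (K + 1))
    (hasDerivAt_sinRemainderDeriv r K) (by simp [sinPartialSum_zero_right])
    (by simp [sinPartialSumDeriv_zero_right]) h

theorem sinRemainder_le_of_derivTwo {r K : ℕ} {a c : ℝ}
    (h : ∀ t ∈ Set.Icc 0 a, sinRemainderDerivTwo r K t ≤ c) : ∀ θ ∈ Set.Icc 0 a,
    θ ^ (2 * r + 1) / ((2 * r + 1).factorial : ℝ) - sinPartialSum r (K + 1) θ ≤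
      c * (θ ^ (1 + 1) / ((1 + 1).factorial : ℝ)) := by
  intro θ hθ
  refine sub_nonneg.1 (nonneg_of_hasDerivAt_hasDerivAt_nonneg
    (fun t => ((hasDerivAt_pow_div_factorial 1 t).const_mul c).sub
      (hasDerivAt_sinRemainder r (K + 1) t))
    (fun t => ((hasDerivAt_pow_div_factorial 0 t).const_mul c).sub
      (hasDerivAt_sinRemainderDeriv r K t)) ?_ ?_ (fun t ht => ?_) θ hθ)
  · simp [sinPartialSum_zero_right]
  · simp [sinPartialSumDeriv_zero_right]
  · simpa using h t ht

theorem oddEsymm_mul_sin_pow_nonneg (r K : ℕ) {θ : ℝ} (hθ : θ ∈ Set.Icc 0 (π / 2)) :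
    0 ≤ oddEsymm r K * (sin θ ^ (2 * K + 1) / sinMoment 0 K) := by
  have h1 : 0 ≤ sin θ := sin_nonneg_of_nonneg_of_le_pi hθ.1 (by linarith [hθ.2, pi_pos])
  exact mul_nonneg (oddEsymm_nonneg r K) (div_nonneg (pow_nonneg h1 _) (sinMoment_nonneg 0 K))

theorem sinPartialSum_le (r K : ℕ) : ∀ θ ∈ Set.Icc 0 (π / 2),
    sinPartialSum r K θ ≤ θ ^ (2 * r + 1) / ((2 * r + 1).factorial : ℝ) := by
  induction r generalizing K with
  | zero =>
    intro θ hθ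
    cases K with
    | zero => simpa [sinPartialSum] using hθ.1
    | succ K =>
      refine sub_nonneg.1 (sinRemainder_nonneg_of_derivTwo (fun t ht => ?_) θ hθ)
      rw [sinRemainderDerivTwo_zero]
      exact oddEsymm_mul_sin_pow_nonneg 0 K ht
  | succ r ih =>
    intro θ hθ
    cases K with
    | zero =>
      have := hθ.1
      simp only [sinPartialSum, Finset.range_zero, Finset.sum_empty]
      positivity
    | succ K =>
      refine sub_nonneg.1 (sinRemainder_nonneg_of_derivTwo (fun t ht => ?_) θ hθ)
      rw [sinRemainderDerivTwo_succ]
      exact add_nonneg (sub_nonneg.2 (ih K t ht)) (oddEsymm_mul_sin_pow_nonneg (r + 1) K ht)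

theorem oddEsymm_le_pow (r K : ℕ) : oddEsymm r K ≤ (K : ℝ) ^ r := by
  induction r generalizing K with
  | zero => simp [oddEsymm]
  | succ r ih =>
    calc oddEsymm (r + 1) K ≤ ∑ _i ∈ Finset.range K, (K : ℝ) ^ r := by
          refine Finset.sum_le_sum fun i hi => ?_
          refine (div_le_self (oddEsymm_nonneg r i) ?_).trans ((ih i).trans ?_)
          · exact one_le_pow₀ (by linarith [(Nat.cast_nonneg i : (0 : ℝ) ≤ i)])
          · have : (i : ℝ) ≤ K := by exact_mod_cast (Finset.mem_range.1 hi).le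
            gcongr
      _ = (K : ℝ) ^ (r + 1) := by simp [pow_succ, mul_comm]

theorem eventually_oddEsymm_mul_sin_pow_le (r : ℕ) {a ε : ℝ} (ha : a ∈ Set.Ico 0 (π / 2))
    (hε : 0 < ε) : ∀ᶠ K : ℕ in atTop, ∀ θ ∈ Set.Icc 0 a,
      oddEsymm r K * (sin θ ^ (2 * K + 1) / sinMoment 0 K) ≤ ε := by
  have hq0 : 0 ≤ sin a := sin_nonneg_of_nonneg_of_le_pi ha.1 (by linarith [ha.2, pi_pos])
  have hq1 : sin a < 1 := by
    rw [← sin_pi_div_two]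
    exact sin_lt_sin_of_lt_of_le_pi_div_two (by linarith [ha.1, pi_pos]) le_rfl ha.2
  have hlim : Tendsto (fun K : ℕ => 2 * ((K : ℝ) ^ (r + 1) * sin a ^ K) + (K : ℝ) ^ r * sin a ^ K)
      atTop (𝓝 (2 * 0 + 0)) :=
    ((tendsto_pow_const_mul_const_pow_of_lt_one (r + 1) hq0 hq1).const_mul 2).add
      (tendsto_pow_const_mul_const_pow_of_lt_one r hq0 hq1)
  filter_upwards [hlim.eventually_le_const (by simpa using hε)] with K hK θ hθ
  refine le_trans ?_ hK
  have h0 : 0 ≤ sin θ :=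
    sin_nonneg_of_nonneg_of_le_pi hθ.1 (by linarith [hθ.2, ha.2, pi_pos])
  have h1 : sin θ ≤ sin a :=
    sin_le_sin_of_le_of_le_pi_div_two (by linarith [hθ.1, pi_pos]) ha.2.le hθ.2
  have h2 : (sinMoment 0 K)⁻¹ ≤ 2 * K + 1 := by
    have := inv_anti₀ (by positivity) (inv_le_sinMoment_zero K)
    rwa [inv_inv] at this
  have h3 : sin θ ^ (2 * K + 1) ≤ sin a ^ K :=
    (pow_le_pow_left₀ h0 h1 _).trans (pow_le_pow_of_le_one hq0 hq1.le (by omega))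
  calc oddEsymm r K * (sin θ ^ (2 * K + 1) / sinMoment 0 K)
      ≤ (K : ℝ) ^ r * (sin a ^ K * (2 * K + 1)) := by
        rw [div_eq_mul_inv]
        have := inv_nonneg.2 (sinMoment_nonneg 0 K)
        gcongr
        exact oddEsymm_le_pow r K
    _ = _ := by ring

theorem eventually_sinRemainder_le (r : ℕ) {a : ℝ} (ha : a ∈ Set.Ico 0 (π / 2)) :
    ∀ ε > 0, ∀ᶠ K : ℕ in atTop, ∀ θ ∈ Set.Icc 0 a,
      θ ^ (2 * r + 1) / ((2 * r + 1).factorial : ℝ) - sinPartialSum r K θ ≤ ε := by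
  have hstep : ∀ r, (∀ ε > 0, ∀ᶠ K : ℕ in atTop, ∀ θ ∈ Set.Icc 0 a,
      sinRemainderDerivTwo r K θ ≤ ε) → ∀ ε > 0, ∀ᶠ K : ℕ in atTop, ∀ θ ∈ Set.Icc 0 a,
      θ ^ (2 * r + 1) / ((2 * r + 1).factorial : ℝ) - sinPartialSum r K θ ≤ ε := by
    intro r h ε hε
    rw [← map_add_atTop_eq_nat 1, eventually_map]
    filter_upwards [h (ε / (a ^ 2 + 1)) (by positivity)] with K hK θ hθ
    refine (sinRemainder_le_of_derivTwo hK θ hθ).trans ?_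
    rw [div_mul_eq_mul_div, div_le_iff₀ (by positivity)]
    have : θ ^ 2 ≤ a ^ 2 := pow_le_pow_left₀ hθ.1 hθ.2 2
    refine mul_le_mul_of_nonneg_left ?_ hε.le
    norm_num
    nlinarith [sq_nonneg a]
  induction r with
  | zero =>
    refine hstep 0 fun ε hε => ?_
    simp_rw [sinRemainderDerivTwo_zero]
    exact eventually_oddEsymm_mul_sin_pow_le 0 ha hε
  | succ r ih =>
    refine hstep (r + 1) fun ε hε => ?_
    filter_upwards [ih (ε / 2) (half_pos hε),
      eventually_oddEsymm_mul_sin_pow_le (r + 1) ha (half_pos hε)] with K h1 h2 θ hθ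
    rw [sinRemainderDerivTwo_succ]
    linarith [h1 θ hθ, h2 θ hθ]

theorem tendsto_sinPartialSum (r : ℕ) {θ : ℝ} (hθ : θ ∈ Set.Ico 0 (π / 2)) :
    Tendsto (fun K => sinPartialSum r K θ) atTop
      (𝓝 (θ ^ (2 * r + 1) / ((2 * r + 1).factorial : ℝ))) := by
  refine tendsto_order.2 ⟨fun b hb => ?_, fun b hb => ?_⟩
  · filter_upwards [eventually_sinRemainder_le r hθ _ (half_pos (sub_pos.2 hb))] with K hK
    linarith [hK θ ⟨hθ.1, le_rfl⟩]
  · exact Eventually.of_forall fun K =>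
      (sinPartialSum_le r K θ ⟨hθ.1, hθ.2.le⟩).trans_lt hb

/-- The common value `∫₀^{π/2} θ^{2r+1}/(2r+1)! · (π/2-θ)^{2s+1}/(2s+1)! · cot θ dθ`. -/
noncomputable def cotIntegral (r s : ℕ) : ℝ :=
  ∫ θ in (0 : ℝ)..π / 2, θ ^ (2 * r + 1) / ((2 * r + 1).factorial : ℝ) *
    (cos θ / sin θ * ((π / 2 - θ) ^ (2 * s + 1) / ((2 * s + 1).factorial : ℝ)))

theorem integral_sin_pow_mul_cos_mul (s j : ℕ) :
    ∫ θ in (0 : ℝ)..π / 2, sin θ ^ (2 * j) * cos θ *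
      ((π / 2 - θ) ^ (2 * s + 1) / ((2 * s + 1).factorial : ℝ)) =
      sinMoment s j / (2 * j + 1) := by
  have hB : ∀ θ, HasDerivAt (fun θ => sin θ ^ (2 * j + 1) *
      ((π / 2 - θ) ^ (2 * s + 1) / ((2 * s + 1).factorial : ℝ)))
      ((2 * j + 1) * (sin θ ^ (2 * j) * cos θ *
        ((π / 2 - θ) ^ (2 * s + 1) / ((2 * s + 1).factorial : ℝ))) -
        sin θ ^ (2 * j + 1) * ((π / 2 - θ) ^ (2 * s) / ((2 * s).factorial : ℝ))) θ := by
    intro θ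
    refine ((hasDerivAt_sin_pow (2 * j) θ).mul
      (hasDerivAt_const_sub_pow_div_factorial (π / 2) θ (2 * s))).congr_deriv ?_
    push_cast
    ring
  have hparts := intervalIntegral.integral_eq_sub_of_hasDerivAt (a := 0) (b := π / 2)
    (fun θ _ => hB θ) (Continuous.intervalIntegrable (by fun_prop) _ _)
  rw [intervalIntegral.integral_sub (Continuous.intervalIntegrable (by fun_prop) _ _)
    (Continuous.intervalIntegrable (by fun_prop) _ _),
    intervalIntegral.integral_const_mul] at hparts
  rw [eq_div_iff (by positivity), sinMoment]
  simp at hparts ⊢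
  linarith

theorem integral_sinPartialSum_mul_cot (r s K : ℕ) :
    ∫ θ in (0 : ℝ)..π / 2, sinPartialSum r K θ *
      (cos θ / sin θ * ((π / 2 - θ) ^ (2 * s + 1) / ((2 * s + 1).factorial : ℝ))) =
      ∑ j ∈ Finset.range K, oddEsymm r j * (sinMomentRatio s j / (2 * j + 1) ^ 3) := by
  have hcongr : ∫ θ in (0 : ℝ)..π / 2, sinPartialSum r K θ *
      (cos θ / sin θ * ((π / 2 - θ) ^ (2 * s + 1) / ((2 * s + 1).factorial : ℝ))) =
      ∫ θ in (0 : ℝ)..π / 2, ∑ j ∈ Finset.range K,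
        oddEsymm r j / ((2 * j + 1) ^ 2 * sinMoment 0 j) * (sin θ ^ (2 * j) * cos θ *
        ((π / 2 - θ) ^ (2 * s + 1) / ((2 * s + 1).factorial : ℝ))) := by
    refine intervalIntegral.integral_congr_ae (Eventually.of_forall fun θ hθ => ?_)
    rw [Set.uIoc_of_le (by positivity)] at hθ
    have h1 : sin θ ≠ 0 := (sin_pos_of_pos_of_lt_pi hθ.1 (by linarith [hθ.2, pi_pos])).ne'
    rw [sinPartialSum, Finset.sum_mul]
    refine Finset.sum_congr rfl fun j _ => ?_
    rw [pow_succ]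
    field_simp
  rw [hcongr, intervalIntegral.integral_finsetSum
    (fun j _ => Continuous.intervalIntegrable (by fun_prop) _ _)]
  refine Finset.sum_congr rfl fun j _ => ?_
  rw [intervalIntegral.integral_const_mul, integral_sin_pow_mul_cos_mul, sinMomentRatio]
  have := (sinMoment_zero_pos j).ne'
  field_simp

theorem hasSum_cotIntegral (r s : ℕ) :
    HasSum (fun j : ℕ => oddEsymm r j * (sinMomentRatio s j / (2 * j + 1) ^ 3))
      (cotIntegral r s) := by
  rw [hasSum_iff_tendsto_nat_of_nonneg (fun j => mul_nonneg (oddEsymm_nonneg r j)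
    (div_nonneg (sinMomentRatio_nonneg s j) (by positivity)))]
  simp_rw [← integral_sinPartialSum_mul_cot]
  refine intervalIntegral.tendsto_integral_filter_of_dominated_convergence
    (fun _ => (π / 2) ^ (2 * r) * (π / 2 * (π / 2) ^ (2 * s + 1)))
    (Eventually.of_forall fun K => ?_) (Eventually.of_forall fun K => Eventually.of_forall
      fun θ hθ => ?_) intervalIntegrable_const (Eventually.of_forall fun θ hθ => ?_)
  · refine Measurable.aestronglyMeasurable ?_
    unfold sinPartialSum
    fun_prop
  · rw [Set.uIoc_of_le (by positivity)] at hθ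
    have hθ' : θ ∈ Set.Icc 0 (π / 2) := ⟨hθ.1.le, hθ.2⟩
    have hsin : 0 < sin θ := sin_pos_of_pos_of_lt_pi hθ.1 (by linarith [hθ.2, pi_pos])
    have hcos : 0 ≤ cos θ := cos_nonneg_of_mem_Icc ⟨by linarith [hθ.1, pi_pos], hθ.2⟩
    have hψ : 0 ≤ π / 2 - θ := by linarith [hθ.2]
    have hP := sinPartialSum_nonneg r K hθ'
    have hP' : sinPartialSum r K θ ≤ (π / 2) ^ (2 * r) * θ := by
      refine (sinPartialSum_le r K θ hθ').trans ((div_le_self ?_ ?_).trans ?_)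
      · exact pow_nonneg hθ'.1 _
      · exact_mod_cast Nat.succ_le_of_lt (Nat.factorial_pos _)
      · rw [pow_succ]
        exact mul_le_mul_of_nonneg_right (pow_le_pow_left₀ hθ'.1 hθ.2 _) hθ'.1
    have hcot : θ * (cos θ / sin θ) ≤ π / 2 := by
      rw [mul_div_assoc', div_le_iff₀ hsin]
      have h2 := mul_le_sin hθ'.1 hθ.2
      calc θ * cos θ ≤ θ * 1 := mul_le_mul_of_nonneg_left (cos_le_one θ) hθ'.1
        _ = π / 2 * (2 / π * θ) := by field_simp
        _ ≤ _ := by gcongr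
    have hpow : (π / 2 - θ) ^ (2 * s + 1) / ((2 * s + 1).factorial : ℝ) ≤
        (π / 2) ^ (2 * s + 1) := by
      refine (div_le_self (by positivity) ?_).trans ?_
      · exact_mod_cast Nat.succ_le_of_lt (Nat.factorial_pos _)
      · exact pow_le_pow_left₀ hψ (by linarith [hθ.1]) _
    rw [Real.norm_of_nonneg (by positivity)]
    calc _ ≤ (π / 2) ^ (2 * r) * θ * (cos θ / sin θ *
          ((π / 2 - θ) ^ (2 * s + 1) / ((2 * s + 1).factorial : ℝ))) := by gcongr
      _ = (π / 2) ^ (2 * r) * (θ * (cos θ / sin θ) *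
          ((π / 2 - θ) ^ (2 * s + 1) / ((2 * s + 1).factorial : ℝ))) := by ring
      _ ≤ _ := by gcongr
  · rw [Set.uIoc_of_le (by positivity)] at hθ
    rcases hθ.2.eq_or_lt with rfl | hlt
    · simp
    · exact (tendsto_sinPartialSum r ⟨hθ.1.le, hlt⟩).mul_const _

theorem MTV_replicate_two_three_eq_cotIntegral (r s : ℕ) :
    MTV (List.replicate r 2 ++ 3 :: List.replicate s 2) = cotIntegral r s := by
  have h := hasSum_cotIntegral r s
  have h0 : ∀ j : ℕ, 0 ≤ oddEsymm r j * (sinMomentRatio s j / (2 * j + 1) ^ 3) := fun j =>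
    mul_nonneg (oddEsymm_nonneg r j) (div_nonneg (sinMomentRatio_nonneg s j) (by positivity))
  rw [MTV_eq_toReal_mtvTail, mtvTail_replicate_two_append]
  simp_rw [mtvTail_replicate_two]
  rw [← h.tsum_eq, ← ENNReal.toReal_ofReal (tsum_nonneg h0),
    ENNReal.ofReal_tsum_of_nonneg h0 h.summable]
  congr 1
  refine tsum_congr fun j => ?_
  rw [← ENNReal.ofReal_mul (by positivity), ← ENNReal.ofReal_mul (oddEsymm_nonneg r j),
    one_div_mul_eq_div]

/-- The real number `ζ(2n)`. -/
noncomputable def zetaEven (n : ℕ) : ℝ := (riemannZeta (2 * n)).re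

theorem zetaEven_zero : zetaEven 0 = -1 / 2 := by
  simp [zetaEven, riemannZeta_zero]

theorem riemannZeta_two_mul_succ (n : ℕ) :
    riemannZeta (2 * (n + 1 : ℕ)) =
      ((∑' m : ℕ, 1 / ((m : ℝ) + 1) ^ (2 * (n + 1)) : ℝ) : ℂ) := by
  have h := zeta_nat_eq_tsum_of_gt_one (k := 2 * (n + 1)) (by omega)
  have hs : Summable fun m : ℕ => 1 / (m : ℝ) ^ (2 * (n + 1)) :=
    Real.summable_one_div_nat_pow.2 (by omega)
  have h2 := hs.tsum_eq_zero_add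
  simp only [Nat.cast_zero, ne_eq, mul_eq_zero, OfNat.ofNat_ne_zero, Nat.succ_ne_zero, or_self,
    not_false_eq_true, zero_pow, div_zero, zero_add, Nat.cast_add, Nat.cast_one] at h2
  rw [← h2, Complex.ofReal_tsum]
  push_cast at h ⊢
  exact h

theorem ofReal_zetaEven (n : ℕ) : (zetaEven n : ℂ) = riemannZeta (2 * n) := by
  cases n with
  | zero => rw [zetaEven_zero]; simp [riemannZeta_zero]
  | succ n => rw [zetaEven, riemannZeta_two_mul_succ, Complex.ofReal_re]

theorem hasSum_zetaEven_succ (n : ℕ) :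
    HasSum (fun m : ℕ => 1 / ((m : ℝ) + 1) ^ (2 * (n + 1))) (zetaEven (n + 1)) := by
  rw [zetaEven, riemannZeta_two_mul_succ, Complex.ofReal_re]
  refine Summable.hasSum ?_
  have := (summable_nat_add_iff 1).2
    (Real.summable_one_div_nat_pow.2 (show 1 < 2 * (n + 1) by omega))
  simpa using this

theorem abs_zetaEven_le (n : ℕ) : |zetaEven n| ≤ 1 / 2 + zetaEven 1 := by
  have h1 : 0 ≤ zetaEven 1 := (hasSum_zetaEven_succ 0).nonneg fun m => by positivity
  cases n with
  | zero => rw [zetaEven_zero]; norm_num; exact h1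
  | succ n =>
    have h0 : 0 ≤ zetaEven (n + 1) := (hasSum_zetaEven_succ n).nonneg fun m => by positivity
    have h2 : zetaEven (n + 1) ≤ zetaEven 1 := by
      refine hasSum_le (fun m => ?_) (hasSum_zetaEven_succ n) (hasSum_zetaEven_succ 0)
      refine one_div_le_one_div_of_le (by positivity) (pow_le_pow_right₀ ?_ (by omega))
      linarith [(Nat.cast_nonneg m : (0 : ℝ) ≤ m)]
    rw [abs_of_nonneg h0]
    linarith

theorem hasSum_cot_partialFraction {x : ℝ} (hx0 : 0 < x) (hx1 : x < 1) :
    HasSum (fun m : ℕ => x ^ 2 / ((m + 1) ^ 2 - x ^ 2))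
      (1 / 2 - π * x / 2 * (cos (π * x) / sin (π * x))) := by
  have hx : (x : ℂ) ∈ Complex.integerComplement := by
    rintro ⟨k, hk⟩
    have hk' : (k : ℝ) = x := by exact_mod_cast hk
    have h1 : 0 < k := by exact_mod_cast hk' ▸ hx0
    have h2 : k < 1 := by exact_mod_cast hk' ▸ hx1
    omega
  have h : HasSum (fun m => cotTerm (x : ℂ) m) (π * Complex.cot (π * x) - 1 / x) := by
    have h := (summable_cotTerm hx).hasSum
    rwa [show ∑' m, cotTerm (x : ℂ) m = _ from (cot_series_rep' hx).symm] at h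
  have h2 := h.mul_left (-(x : ℂ) / 2)
  rw [← Complex.hasSum_ofReal]
  convert! h2 using 1
  · funext m
    rw [cotTerm_identity hx]
    have hm : (0 : ℝ) < (m + 1) ^ 2 - x ^ 2 := by
      nlinarith [(Nat.cast_nonneg m : (0 : ℝ) ≤ m)]
    have hm' : ((m : ℂ) + 1) ^ 2 - x ^ 2 ≠ 0 := by exact_mod_cast hm.ne'
    have hm2 : ((x : ℂ) + (m + 1)) * (x - (m + 1)) = -(((m : ℂ) + 1) ^ 2 - x ^ 2) := by ring
    rw [hm2]
    push_cast
    field_simp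
  · have hxc : (x : ℂ) ≠ 0 := by exact_mod_cast hx0.ne'
    push_cast
    rw [Complex.cot_eq_cos_div_sin]
    field_simp
    ring

/-- The generating function of `ζ(2n)`: `∑ ζ(2n) x^{2n} = -(πx/2) cot(πx)`. -/
theorem hasSum_zetaEven_mul_pow {x : ℝ} (hx0 : 0 < x) (hx1 : x < 1) :
    HasSum (fun n : ℕ => zetaEven n * x ^ (2 * n))
      (-(π * x / 2 * (cos (π * x) / sin (π * x)))) := by
  let f : ℕ × ℕ → ℝ := fun p => x ^ (2 * (p.2 + 1)) * (1 / ((p.1 : ℝ) + 1) ^ (2 * (p.2 + 1)))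
  have hrow : ∀ m : ℕ, HasSum (fun n => f (m, n)) (x ^ 2 / ((m + 1) ^ 2 - x ^ 2)) := by
    intro m
    have hm : (0 : ℝ) < (m + 1) ^ 2 - x ^ 2 := by
      nlinarith [(Nat.cast_nonneg m : (0 : ℝ) ≤ m)]
    have hlt : x ^ 2 / ((m : ℝ) + 1) ^ 2 < 1 := by
      rw [div_lt_one (by positivity)]
      linarith
    have hg := (hasSum_geometric_of_lt_one (by positivity) hlt).mul_left
      (x ^ 2 / ((m : ℝ) + 1) ^ 2)
    convert! hg using 1
    · funext n
      simp only [f]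
      rw [← pow_succ', div_pow, ← pow_mul, ← pow_mul, mul_one_div]
    · have : (1 - x ^ 2 / ((m : ℝ) + 1) ^ 2) = ((m + 1) ^ 2 - x ^ 2) / (m + 1) ^ 2 := by
        field_simp
      rw [this]
      field_simp
  have hf0 : 0 ≤ f := fun p => by positivity
  have hcot := hasSum_cot_partialFraction hx0 hx1
  have hf : Summable f := by
    rw [summable_prod_of_nonneg hf0]
    refine ⟨fun m => (hrow m).summable, ?_⟩
    simp_rw [fun m => (hrow m).tsum_eq]
    exact hcot.summable
  have htot : ∑' p, f p = 1 / 2 - π * x / 2 * (cos (π * x) / sin (π * x)) :=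
    (hf.hasSum.prod_fiberwise hrow).unique hcot
  have hswap : HasSum (fun p : ℕ × ℕ => f p.swap) (∑' p, f p) :=
    (Equiv.prodComm ℕ ℕ).hasSum_iff.2 hf.hasSum
  have hcol : ∀ n : ℕ, HasSum (fun m => f (m, n)) (zetaEven (n + 1) * x ^ (2 * (n + 1))) := by
    intro n
    rw [mul_comm]
    exact (hasSum_zetaEven_succ n).mul_left _
  have hsum := hswap.prod_fiberwise hcol
  rw [← hasSum_nat_add_iff' 1]
  convert! hsum using 1
  rw [htot]
  simp [zetaEven_zero]
  ring

theorem integral_pow_mul_const_sub_pow (c : ℝ) (a b : ℕ) :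
    ∫ θ in (0 : ℝ)..c, θ ^ a / (a.factorial : ℝ) * ((c - θ) ^ b / (b.factorial : ℝ)) =
      c ^ (a + b + 1) / ((a + b + 1).factorial : ℝ) := by
  induction b generalizing a with
  | zero =>
    have h := intervalIntegral.integral_eq_sub_of_hasDerivAt (a := 0) (b := c)
      (fun θ _ => hasDerivAt_pow_div_factorial a θ)
      (Continuous.intervalIntegrable (by fun_prop) _ _)
    simpa using h
  | succ b ih =>
    have h := intervalIntegral.integral_eq_sub_of_hasDerivAt (a := 0) (b := c)
      (fun θ _ => (hasDerivAt_pow_div_factorial a θ).mul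
        (hasDerivAt_const_sub_pow_div_factorial c θ b))
      (Continuous.intervalIntegrable (by fun_prop) _ _)
    rw [intervalIntegral.integral_add (Continuous.intervalIntegrable (by fun_prop) _ _)
      (Continuous.intervalIntegrable (by fun_prop) _ _)] at h
    simp only [mul_neg, intervalIntegral.integral_neg, ih (a + 1)] at h
    simp only [Pi.mul_apply, sub_self, ne_eq, Nat.succ_ne_zero, not_false_eq_true, zero_pow,
      zero_div, mul_zero, zero_mul] at h
    rw [show a + (b + 1) + 1 = a + 1 + b + 1 by ring]
    linarith

theorem hasSum_zetaEven_cotIntegral (r s : ℕ) :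
    HasSum (fun n : ℕ => -2 * zetaEven n * ((2 * n + 2 * r).factorial : ℝ) /
        (((2 * r + 1).factorial : ℝ) * π ^ (2 * n)) *
        ((π / 2) ^ (2 * n + 2 * r + (2 * s + 1) + 1) /
          ((2 * n + 2 * r + (2 * s + 1) + 1).factorial : ℝ)))
      (cotIntegral r s) := by
  simp_rw [← integral_pow_mul_const_sub_pow, ← intervalIntegral.integral_const_mul]
  have hexpand : ∀ (n : ℕ) (θ : ℝ), -2 * zetaEven n * ((2 * n + 2 * r).factorial : ℝ) /
        (((2 * r + 1).factorial : ℝ) * π ^ (2 * n)) * (θ ^ (2 * n + 2 * r) /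
          ((2 * n + 2 * r).factorial : ℝ) *
          ((π / 2 - θ) ^ (2 * s + 1) / ((2 * s + 1).factorial : ℝ))) =
      -2 * (θ ^ (2 * r) / ((2 * r + 1).factorial : ℝ) *
        ((π / 2 - θ) ^ (2 * s + 1) / ((2 * s + 1).factorial : ℝ))) *
        (zetaEven n * (θ / π) ^ (2 * n)) := by
    intro n θ
    have := (Nat.factorial_pos (2 * n + 2 * r)).ne'
    rw [div_pow, pow_add]
    field_simp
  simp_rw [hexpand]
  refine intervalIntegral.hasSum_integral_of_dominated_convergence
    (fun n _ => 2 * ((π / 2) ^ (2 * r) * (π / 2) ^ (2 * s + 1)) *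
      ((1 / 2 + zetaEven 1) * (1 / 4 : ℝ) ^ n)) (fun n => ?_)
    (fun n => Eventually.of_forall fun θ hθ => ?_) (Eventually.of_forall fun θ _ => ?_)
    intervalIntegrable_const (Eventually.of_forall fun θ hθ => ?_)
  · exact Continuous.aestronglyMeasurable (by fun_prop)
  · rw [Set.uIoc_of_le (by positivity)] at hθ
    have h0 := hθ.1
    have hψ : 0 ≤ π / 2 - θ := by linarith [hθ.2]
    have hpow : (π / 2 - θ) ^ (2 * s + 1) / ((2 * s + 1).factorial : ℝ) ≤
        (π / 2) ^ (2 * s + 1) := by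
      refine (div_le_self (by positivity) ?_).trans ?_
      · exact_mod_cast Nat.succ_le_of_lt (Nat.factorial_pos _)
      · exact pow_le_pow_left₀ hψ (by linarith [hθ.1]) _
    have hpow' : θ ^ (2 * r) / ((2 * r + 1).factorial : ℝ) ≤ (π / 2) ^ (2 * r) := by
      refine (div_le_self (by positivity) ?_).trans ?_
      · exact_mod_cast Nat.succ_le_of_lt (Nat.factorial_pos _)
      · exact pow_le_pow_left₀ h0.le hθ.2 _
    have hratio : (θ / π) ^ (2 * n) ≤ (1 / 4 : ℝ) ^ n := by
      rw [pow_mul]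
      refine pow_le_pow_left₀ (by positivity) ?_ n
      have h1 : θ / π ≤ 1 / 2 := by
        rw [div_le_iff₀ pi_pos]
        linarith [hθ.2]
      nlinarith [div_nonneg h0.le pi_pos.le]
    rw [norm_mul, norm_mul, norm_mul (zetaEven n), Real.norm_of_nonneg
      (show 0 ≤ θ ^ (2 * r) / ((2 * r + 1).factorial : ℝ) *
        ((π / 2 - θ) ^ (2 * s + 1) / ((2 * s + 1).factorial : ℝ)) by positivity),
      Real.norm_of_nonneg (show 0 ≤ (θ / π) ^ (2 * n) by positivity), norm_neg,
      Real.norm_of_nonneg (show (0 : ℝ) ≤ 2 by norm_num), Real.norm_eq_abs]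
    have := abs_zetaEven_le n
    have := (abs_nonneg (zetaEven n)).trans this
    gcongr
  · exact ((summable_geometric_of_lt_one (by norm_num) (by norm_num)).mul_left _).mul_left _
  · rw [Set.uIoc_of_le (by positivity)] at hθ
    have hx1 : θ / π < 1 := by
      rw [div_lt_one pi_pos]
      linarith [hθ.2, pi_pos]
    have h := (hasSum_zetaEven_mul_pow (div_pos hθ.1 pi_pos) hx1).mul_left
      (-2 * (θ ^ (2 * r) / ((2 * r + 1).factorial : ℝ) *
        ((π / 2 - θ) ^ (2 * s + 1) / ((2 * s + 1).factorial : ℝ))))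
    convert! h using 1
    rw [mul_div_cancel₀ θ pi_ne_zero, pow_succ]
    ring

theorem factorial_mul_prod_Icc (a b : ℕ) :
    a.factorial * ∏ i ∈ Finset.Icc (a + 1) (a + b), i = (a + b).factorial := by
  induction b with
  | zero => simp
  | succ b ih =>
    rw [← add_assoc, Finset.prod_Icc_succ_top (by omega), ← mul_assoc, ih, Nat.factorial_succ,
      mul_comm]

theorem stmt_9 (r s : ℕ) :
    (MTV (List.replicate r 2 ++ 3 :: List.replicate s 2) : ℂ) =
      (-2 / (Nat.factorial (2 * r + 1) : ℂ)) * ((Real.pi : ℂ) / 2) ^ (2 * r + 2 * s + 2) *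
        ∑' n : ℕ, riemannZeta (2 * n) /
          ((∏ i ∈ Finset.Icc (2 * n + 2 * r + 1) (2 * n + 2 * r + 2 * s + 2), (i : ℂ))
            * 2 ^ (2 * n)) := by
  rw [MTV_replicate_two_three_eq_cotIntegral,
    ← (Complex.hasSum_ofReal.2 (hasSum_zetaEven_cotIntegral r s)).tsum_eq, ← tsum_mul_left]
  refine tsum_congr fun n => ?_
  have hfac := factorial_mul_prod_Icc (2 * n + 2 * r) (2 * s + 2)
  rw [← add_assoc] at hfac
  have hprod : (((2 * n + 2 * r).factorial : ℕ) : ℂ) *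
      ∏ i ∈ Finset.Icc (2 * n + 2 * r + 1) (2 * n + 2 * r + 2 * s + 2), (i : ℂ) =
      ((2 * n + 2 * r + 2 * s + 2).factorial : ℕ) := by
    rw [← Nat.cast_prod, ← Nat.cast_mul, hfac]
  have hne : (((2 * n + 2 * r + 2 * s + 2).factorial : ℕ) : ℂ) ≠ 0 := by
    exact_mod_cast (Nat.factorial_pos _).ne'
  have hne1 : (((2 * n + 2 * r).factorial : ℕ) : ℂ) ≠ 0 := by
    exact_mod_cast (Nat.factorial_pos _).ne'
  have hne2 : ∏ i ∈ Finset.Icc (2 * n + 2 * r + 1) (2 * n + 2 * r + 2 * s + 2), (i : ℂ) ≠ 0 :=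
    right_ne_zero_of_mul (hprod ▸ hne)
  have hpi : (π : ℂ) ≠ 0 := by exact_mod_cast pi_ne_zero
  rw [show 2 * n + 2 * r + (2 * s + 1) + 1 = 2 * n + 2 * r + 2 * s + 2 by ring]
  push_cast
  rw [ofReal_zetaEven, ← hprod,
    show 2 * n + 2 * r + 2 * s + 2 = 2 * n + (2 * r + 2 * s + 2) by ring, pow_add,
    div_pow _ _ (2 * n)]
  rw [show 2 * n + (2 * r + 2 * s + 2) = 2 * n + 2 * r + 2 * s + 2 by ring]
  field_simp
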